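/- Let (X,d,m) be an mm-space with m(X) = 1 satisfying CD(K,∞) for some K > 0. Then for every bounded Lipschitz function ρ : X → [0,∞) with ∫ ρ dm = 1: ∫ ρ log ρ dm ≤ (1/(2K))·∫_{ρ>0} (lip ρ)²/ρ dm (logarithmic Sobolev inequality). -/

import Mathlib

open MeasureTheory Filter Set Topology ENNReal
open scoped Classical

noncomputable section

/-- A coupling of two measures. -/
def IsCoupling {α β : Type*} [MeasurableSpace α] [MeasurableSpace β]
    (q : Measure (α × β)) (μ : Measure α) (ν : Measure β) : Prop :=
  Measure.map Prod.fst q = μ ∧ Measure.map Prod.snd q = ν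

/-- Membership in the Wasserstein space `P₂`. -/
def MemP2 {α : Type*} [MetricSpace α] [MeasurableSpace α] (μ : Measure α) : Prop :=
  IsProbabilityMeasure μ ∧ ∃ x₀ : α, ∫⁻ x, edist x x₀ ^ 2 ∂μ < ∞

/-- The squared Kantorovich–Wasserstein distance. -/
def Wsq {α : Type*} [MetricSpace α] [MeasurableSpace α] (μ ν : Measure α) : ℝ≥0∞ :=
  ⨅ (q : Measure (α × α)) (_ : IsCoupling q μ ν), ∫⁻ p, edist p.1 p.2 ^ 2 ∂q

/-- The Kantorovich–Wasserstein distance `W₂`. -/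
def W2 {α : Type*} [MetricSpace α] [MeasurableSpace α] (μ ν : Measure α) : ℝ≥0∞ :=
  Wsq μ ν ^ (1/2 : ℝ)

/-- A `W₂`-geodesic parametrized by `[0,1]`. -/
def IsW2Geodesic {α : Type*} [MetricSpace α] [MeasurableSpace α] (μ : ℝ → Measure α) : Prop :=
  ∀ s ∈ Icc (0:ℝ) 1, ∀ t ∈ Icc (0:ℝ) 1,
    W2 (μ s) (μ t) = ENNReal.ofReal |s - t| * W2 (μ 0) (μ 1)

/-- Integrand of the Boltzmann entropy. -/
def entFun {α : Type*} [MeasurableSpace α] (μ m : Measure α) (x : α) : ℝ :=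
  (μ.rnDeriv m x).toReal * Real.log (μ.rnDeriv m x).toReal

/-- Boltzmann entropy `Ent(μ|m)`. -/
def Ent {α : Type*} [MeasurableSpace α] (μ m : Measure α) : EReal :=
  if μ ≪ m ∧ Integrable (fun x => max (entFun μ m x) 0) m then
    ((∫ x, max (entFun μ m x) 0 ∂m : ℝ) : EReal)
      - ((∫⁻ x, ENNReal.ofReal (-(entFun μ m x)) ∂m : ℝ≥0∞) : EReal)
  else ⊤

/-- The CD(K,∞) convexity inequality along some geodesic from `μ₀` to `μ₁`. -/
def CDinftyFor {α : Type*} [MetricSpace α] [MeasurableSpace α]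
    (K : ℝ) (m μ₀ μ₁ : Measure α) : Prop :=
  ∃ μ : ℝ → Measure α, μ 0 = μ₀ ∧ μ 1 = μ₁ ∧ IsW2Geodesic μ ∧
    ∀ t ∈ Icc (0:ℝ) 1,
      Ent (μ t) m ≤ ((1 - t : ℝ) : EReal) * Ent μ₀ m + ((t : ℝ) : EReal) * Ent μ₁ m
        - ((K/2 * (t * (1-t)) : ℝ) : EReal) * ((Wsq μ₀ μ₁ : ℝ≥0∞) : EReal)

/-- The curvature-dimension condition CD(K,∞). -/
def CDinfty {α : Type*} [MetricSpace α] [MeasurableSpace α] (K : ℝ) (m : Measure α) : Prop :=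
  ∀ μ₀ μ₁ : Measure α, MemP2 μ₀ → MemP2 μ₁ → CDinftyFor K m μ₀ μ₁

/-- Distortion coefficients `τ^{(t)}_{K,N}(θ)`. -/
def tauCoef (K N t θ : ℝ) : ℝ≥0∞ :=
  if 0 < K then
    if Real.pi * Real.sqrt ((N-1)/K) ≤ θ then ∞
    else ENNReal.ofReal (t ^ (1/N) *
      (Real.sin (Real.sqrt (K/(N-1)) * (t * θ)) / Real.sin (Real.sqrt (K/(N-1)) * θ)) ^ ((N-1)/N))
  else if K = 0 then ENNReal.ofReal t
  else ENNReal.ofReal (t ^ (1/N) *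
      (Real.sinh (Real.sqrt (-K/(N-1)) * (t * θ)) / Real.sinh (Real.sqrt (-K/(N-1)) * θ)) ^ ((N-1)/N))

/-- The CD(K,N) inequality along some geodesic/optimal coupling from `μ₀` to `μ₁`,
with distortion coefficients `coef`. -/
def CDForWith {α : Type*} [MetricSpace α] [MeasurableSpace α]
    (coef : ℝ → ℝ → ℝ≥0∞) (N : ℝ) (m μ₀ μ₁ : Measure α) : Prop :=
  ∃ (μ : ℝ → Measure α) (q : Measure (α × α)),
    μ 0 = μ₀ ∧ μ 1 = μ₁ ∧ IsW2Geodesic μ ∧ (∀ t ∈ Icc (0:ℝ) 1, μ t ≪ m) ∧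
    IsCoupling q μ₀ μ₁ ∧ (∫⁻ p, edist p.1 p.2 ^ 2 ∂q) = Wsq μ₀ μ₁ ∧
    ∀ t ∈ Icc (0:ℝ) 1,
      ∫⁻ x, ((μ t).rnDeriv m x) ^ (1 - 1/N : ℝ) ∂m ≥
      ∫⁻ p, coef (1-t) (dist p.1 p.2) * (μ₀.rnDeriv m p.1) ^ (-(1/N) : ℝ)
            + coef t (dist p.1 p.2) * (μ₁.rnDeriv m p.2) ^ (-(1/N) : ℝ) ∂q

def CDFor {α : Type*} [MetricSpace α] [MeasurableSpace α]
    (K N : ℝ) (m μ₀ μ₁ : Measure α) : Prop :=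
  CDForWith (fun t θ => tauCoef K N t θ) N m μ₀ μ₁

/-- The curvature-dimension condition CD(K,N). -/
def CD {α : Type*} [MetricSpace α] [MeasurableSpace α] (K N : ℝ) (m : Measure α) : Prop :=
  ∀ μ₀ μ₁ : Measure α, MemP2 μ₀ → MemP2 μ₁ → μ₀ ≪ m → μ₁ ≪ m → CDFor K N m μ₀ μ₁

/-- The support of a measure on a topological space. -/
def mmSupp {α : Type*} [TopologicalSpace α] [MeasurableSpace α] (μ : Measure α) : Set α :=
  {x | ∀ U ∈ nhds x, 0 < μ U}


/-- The local Lipschitz slope `lip u (x) = limsup_{y → x} |u y - u x| / d(x,y)`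
(equal to `0` at isolated points). -/
def lipSlope {α : Type*} [MetricSpace α] (u : α → ℝ) (x : α) : ℝ :=
  Filter.limsup (fun y => |u y - u x| / dist y x) (nhdsWithin x {x}ᶜ)

lemma Ent_eq_integral {α : Type*} [MeasurableSpace α] (μ m : Measure α)
    (hac : μ ≪ m) (hIntg : Integrable (entFun μ m) m) :
    Ent μ m = ((∫ x, entFun μ m x ∂m : ℝ) : EReal) := by
  have h1 : Integrable (fun x => max (entFun μ m x) 0) m := hIntg.pos_part
  have h2 : Integrable (fun x => max (-(entFun μ m x)) 0) m := hIntg.neg_part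
  rw [Ent, if_pos ⟨hac, h1⟩]
  have h3 : (∫⁻ x, ENNReal.ofReal (-(entFun μ m x)) ∂m)
      = ENNReal.ofReal (∫ x, max (-(entFun μ m x)) 0 ∂m) := by
    rw [ofReal_integral_eq_lintegral_ofReal h2 (ae_of_all _ fun x => le_max_right _ _)]
    refine lintegral_congr fun x => ?_
    rw [ENNReal.ofReal_max]; simp
  rw [h3, EReal.coe_ennreal_ofReal, max_eq_left (integral_nonneg (f := fun x => max (-(entFun μ m x)) 0) fun x => le_max_right _ _),
    ← EReal.coe_sub, ← integral_sub h1 h2]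
  congr 2
  funext x
  rcases le_total (entFun μ m x) 0 with h | h
  · rw [max_eq_right h, max_eq_left (by linarith)]; ring
  · rw [max_eq_left h, max_eq_right (by linarith)]; ring

lemma mul_log_ge (u : ℝ) (hu : 0 ≤ u) (v : ℝ) : u * v + u - Real.exp v ≤ u * Real.log u := by
  rcases hu.eq_or_lt with h | h
  · subst h; simp; positivity
  · have := Real.add_one_le_exp (v - Real.log u)
    rw [Real.exp_sub, Real.exp_log h] at this
    have h2 := mul_le_mul_of_nonneg_left this hu
    rw [mul_div_cancel₀ _ h.ne'] at h2
    linarith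

lemma measurable_entFun {α : Type*} [MeasurableSpace α] (μ m : Measure α) :
    Measurable (entFun μ m) := by
  have : Measurable fun x => (μ.rnDeriv m x).toReal := (Measure.measurable_rnDeriv μ m).ennreal_toReal
  exact this.mul (Real.measurable_log.comp this)

lemma Ent_ge {α : Type*} [MeasurableSpace α] (μ m : Measure α) [IsProbabilityMeasure μ]
    [IsProbabilityMeasure m] (f : α → ℝ) (hf : Measurable f) (C : ℝ) (hC : ∀ x, |f x| ≤ C)
    (hexp : ∫ x, Real.exp (f x) ∂m ≤ 1) :
    ((∫ x, f x ∂μ : ℝ) : EReal) ≤ Ent μ m := by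
  by_cases h : μ ≪ m ∧ Integrable (fun x => max (entFun μ m x) 0) m
  · obtain ⟨hac, hpos⟩ := h
    have hIntg : Integrable (entFun μ m) m := by
      refine Integrable.mono' (hpos.add (integrable_const (1:ℝ)))
        (measurable_entFun μ m).aestronglyMeasurable (ae_of_all _ fun x => ?_)
      have := mul_log_ge (μ.rnDeriv m x).toReal ENNReal.toReal_nonneg 0
      have h0 : 0 ≤ (μ.rnDeriv m x).toReal := ENNReal.toReal_nonneg
      rw [Real.exp_zero] at this
      simp only [Pi.add_apply, Real.norm_eq_abs]
      rw [abs_le]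
      have e : entFun μ m x = (μ.rnDeriv m x).toReal * Real.log (μ.rnDeriv m x).toReal := rfl
      have := le_max_left (entFun μ m x) 0
      have := le_max_right (entFun μ m x) 0
      constructor <;> linarith
    rw [Ent_eq_integral μ m hac hIntg, EReal.coe_le_coe_iff]
    have hu : Integrable (fun x => (μ.rnDeriv m x).toReal) m := Measure.integrable_toReal_rnDeriv
    have huf : Integrable (fun x => (μ.rnDeriv m x).toReal * f x) m :=
      hu.mul_bdd (c := C) hf.aestronglyMeasurable (ae_of_all _ hC)
    have hE : Integrable (fun x => Real.exp (f x)) m := by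
      refine Integrable.mono' (integrable_const (Real.exp C))
        (Real.measurable_exp.comp hf).aestronglyMeasurable (ae_of_all _ fun x => ?_)
      rw [Real.norm_eq_abs, abs_of_pos (Real.exp_pos _)]
      exact Real.exp_le_exp.2 ((le_abs_self _).trans (hC x))
    have h1 : ∫ x, f x ∂μ = ∫ x, (μ.rnDeriv m x).toReal * f x ∂m :=
      (integral_rnDeriv_smul hac).symm
    have h2 : ∫ x, (μ.rnDeriv m x).toReal ∂m = 1 := by
      rw [Measure.integral_toReal_rnDeriv hac]; simp
    have h3 : ∫ x, ((μ.rnDeriv m x).toReal * f x + (μ.rnDeriv m x).toReal - Real.exp (f x)) ∂m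
        ≤ ∫ x, entFun μ m x ∂m :=
      integral_mono ((huf.add hu).sub hE) hIntg
        (fun x => mul_log_ge _ ENNReal.toReal_nonneg (f x))
    have h4 := integral_sub (huf.add hu) hE
    have h5 := integral_add huf hu
    simp only [Pi.add_apply] at h4 h5
    rw [h4, h5] at h3
    linarith
  · rw [Ent, if_neg h]; exact le_top

lemma prob_withDensity {α : Type*} [MeasurableSpace α] (m : Measure α) [IsProbabilityMeasure m]
    (r : α → ℝ) (hr : Measurable r) (h0 : ∀ x, 0 ≤ r x) (C : ℝ) (hC : ∀ x, r x ≤ C)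
    (h1 : ∫ x, r x ∂m = 1) :
    IsProbabilityMeasure (m.withDensity fun x => ENNReal.ofReal (r x)) := by
  constructor
  have hi : Integrable r m := Integrable.mono' (integrable_const C) hr.aestronglyMeasurable
    (ae_of_all _ fun x => by rw [Real.norm_eq_abs, abs_of_nonneg (h0 x)]; exact hC x)
  rw [withDensity_apply _ MeasurableSet.univ, Measure.restrict_univ,
    ← ofReal_integral_eq_lintegral_ofReal hi (ae_of_all _ h0), h1, ENNReal.ofReal_one]

lemma integrable_mul_log {α : Type*} [MeasurableSpace α] (m : Measure α) [IsProbabilityMeasure m]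
    (r : α → ℝ) (hr : Measurable r) (h0 : ∀ x, 0 ≤ r x) (C : ℝ) (hC : ∀ x, r x ≤ C) :
    Integrable (fun x => r x * Real.log (r x)) m := by
  obtain ⟨B, hB⟩ := (isCompact_Icc (a := (0:ℝ)) (b := C)).exists_bound_of_continuousOn
    Real.continuous_mul_log.continuousOn
  exact Integrable.mono' (integrable_const B)
    (hr.mul (Real.measurable_log.comp hr)).aestronglyMeasurable
    (ae_of_all _ fun x => hB _ ⟨h0 x, hC x⟩)

lemma Ent_withDensity {α : Type*} [MeasurableSpace α] (m : Measure α) [IsProbabilityMeasure m]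
    (r : α → ℝ) (hr : Measurable r) (h0 : ∀ x, 0 ≤ r x) (C : ℝ) (hC : ∀ x, r x ≤ C) :
    Ent (m.withDensity fun x => ENNReal.ofReal (r x)) m
      = ((∫ x, r x * Real.log (r x) ∂m : ℝ) : EReal) := by
  have hae : entFun (m.withDensity fun x => ENNReal.ofReal (r x)) m
      =ᵐ[m] fun x => r x * Real.log (r x) := by
    filter_upwards [Measure.rnDeriv_withDensity m hr.ennreal_ofReal] with x hx
    rw [entFun, hx, ENNReal.toReal_ofReal (h0 x)]
  rw [Ent_eq_integral _ _ (withDensity_absolutelyContinuous _ _)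
    ((integrable_mul_log m r hr h0 C hC).congr hae.symm), integral_congr_ae hae]

lemma memP2_withDensity {X : Type*} [MetricSpace X] [TopologicalSpace.SeparableSpace X]
    [MeasurableSpace X] [BorelSpace X]
    (m : Measure X) [IsProbabilityMeasure m] (hm : MemP2 m)
    (r : X → ℝ) (hr : Measurable r) (h0 : ∀ x, 0 ≤ r x) (C : ℝ) (hC : ∀ x, r x ≤ C)
    (h1 : ∫ x, r x ∂m = 1) : MemP2 (m.withDensity fun x => ENNReal.ofReal (r x)) := by
  refine ⟨prob_withDensity m r hr h0 C hC h1, ?_⟩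
  obtain ⟨_, x₀, hx⟩ := hm
  have := UniformSpace.secondCountable_of_separable X
  refine ⟨x₀, ?_⟩
  rw [lintegral_withDensity_eq_lintegral_mul _ hr.ennreal_ofReal (by fun_prop)]
  calc _ ≤ ∫⁻ x, ENNReal.ofReal C * edist x x₀ ^ 2 ∂m := by
        refine lintegral_mono fun x => ?_
        exact mul_le_mul' (ENNReal.ofReal_le_ofReal (hC x)) le_rfl
    _ = ENNReal.ofReal C * ∫⁻ x, edist x x₀ ^ 2 ∂m := lintegral_const_mul _ (by fun_prop)
    _ < ∞ := ENNReal.mul_lt_top ENNReal.ofReal_lt_top hx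

lemma ennreal_add_sq_le (a b : ℝ≥0∞) : (a + b) ^ 2 ≤ 4 * (a ^ 2 + b ^ 2) := by
  have h : a + b ≤ 2 * max a b := by
    rw [two_mul]; exact add_le_add (le_max_left _ _) (le_max_right _ _)
  calc (a + b) ^ 2 ≤ (2 * max a b) ^ 2 := by gcongr
    _ = 4 * (max a b) ^ 2 := by rw [mul_pow]; norm_num
    _ ≤ 4 * (a ^ 2 + b ^ 2) := by
      gcongr
      rcases le_total a b with h | h
      · rw [max_eq_right h]; exact le_add_self
      · rw [max_eq_left h]; exact le_self_add

lemma IsCoupling.prob_left {α β : Type*} [MeasurableSpace α] [MeasurableSpace β]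
    {q : Measure (α × β)} {μ : Measure α} {ν : Measure β} (h : IsCoupling q μ ν)
    [IsProbabilityMeasure μ] : IsProbabilityMeasure q := by
  constructor
  rw [← measure_univ (μ := μ), ← h.1, Measure.map_apply measurable_fst MeasurableSet.univ,
    preimage_univ]

lemma IsCoupling.prob_right {α β : Type*} [MeasurableSpace α] [MeasurableSpace β]
    {q : Measure (α × β)} {μ : Measure α} {ν : Measure β} (h : IsCoupling q μ ν)
    [IsProbabilityMeasure μ] : IsProbabilityMeasure ν := by
  have := h.prob_left
  constructor
  rw [← h.2, Measure.map_apply measurable_snd MeasurableSet.univ, preimage_univ, measure_univ]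

lemma exists_coupling_of_Wsq_lt {α : Type*} [MetricSpace α] [MeasurableSpace α]
    {μ ν : Measure α} {c : ℝ≥0∞} (h : Wsq μ ν < c) :
    ∃ q : Measure (α × α), IsCoupling q μ ν ∧ ∫⁻ p, edist p.1 p.2 ^ 2 ∂q < c := by
  simp only [Wsq, iInf_lt_iff] at h
  obtain ⟨q, hq, h⟩ := h
  exact ⟨q, hq, h⟩

lemma Wsq_lt_top {X : Type*} [MetricSpace X] [TopologicalSpace.SeparableSpace X]
    [MeasurableSpace X] [BorelSpace X] {μ ν : Measure X} (hμ : MemP2 μ) (hν : MemP2 ν) :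
    Wsq μ ν < ∞ := by
  obtain ⟨_, x₀, hx⟩ := hμ
  obtain ⟨_, y₀, hy⟩ := hν
  have := UniformSpace.secondCountable_of_separable X
  have hc : IsCoupling (μ.prod ν) μ ν := by
    constructor
    · rw [Measure.map_fst_prod]; simp
    · rw [Measure.map_snd_prod]; simp
  refine lt_of_le_of_lt (iInf₂_le (μ.prod ν) hc) ?_
  have hb : ∀ p : X × X, edist p.1 p.2 ^ 2
      ≤ 4 * (edist p.1 x₀ ^ 2 + 4 * (edist x₀ y₀ ^ 2 + edist p.2 y₀ ^ 2)) := by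
    intro p
    calc edist p.1 p.2 ^ 2 ≤ (edist p.1 x₀ + (edist x₀ y₀ + edist p.2 y₀)) ^ 2 := by
          gcongr
          refine (edist_triangle _ x₀ _).trans ?_
          gcongr
          refine (edist_triangle _ y₀ _).trans ?_
          rw [edist_comm y₀]
      _ ≤ _ := by
          refine (ennreal_add_sq_le _ _).trans ?_
          gcongr
          exact ennreal_add_sq_le _ _
  refine lt_of_le_of_lt (lintegral_mono hb) ?_
  have h1 : ∫⁻ p : X × X, edist p.1 x₀ ^ 2 ∂(μ.prod ν) = ∫⁻ x, edist x x₀ ^ 2 ∂μ := by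
    conv_rhs => rw [← hc.1]
    rw [lintegral_map (by fun_prop) measurable_fst]
  have h2 : ∫⁻ p : X × X, edist p.2 y₀ ^ 2 ∂(μ.prod ν) = ∫⁻ x, edist x y₀ ^ 2 ∂ν := by
    conv_rhs => rw [← hc.2]
    rw [lintegral_map (by fun_prop) measurable_snd]
  rw [lintegral_const_mul _ (by fun_prop), lintegral_add_left (by fun_prop),
    lintegral_const_mul _ (by fun_prop), lintegral_add_left (by fun_prop), h1, h2]
  simp only [lintegral_const, measure_univ, mul_one]
  have h3 : edist x₀ y₀ < ∞ := edist_lt_top _ _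
  finiteness

lemma geod_Wsq {α : Type*} [MetricSpace α] [MeasurableSpace α] {μ : ℝ → Measure α}
    (h : IsW2Geodesic μ) {t : ℝ} (ht : t ∈ Icc (0:ℝ) 1) :
    Wsq (μ 0) (μ t) = ENNReal.ofReal (t ^ 2) * Wsq (μ 0) (μ 1) := by
  have h1 := h 0 ⟨le_rfl, zero_le_one⟩ t ht
  have key : ∀ a b : Measure α, W2 a b ^ 2 = Wsq a b := by
    intro a b
    rw [W2, ← ENNReal.rpow_natCast, ← ENNReal.rpow_mul]; norm_num
  rw [← key, ← key, h1, mul_pow, zero_sub, abs_neg, abs_of_nonneg ht.1,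
    ENNReal.ofReal_pow ht.1]

lemma cd_real {X : Type*} [MetricSpace X] [TopologicalSpace.SeparableSpace X]
    [MeasurableSpace X] [BorelSpace X] (m : Measure X) [IsProbabilityMeasure m]
    (K : ℝ) (hCD : CDinfty K m) {μ₀ μ₁ : Measure X} (h0 : MemP2 μ₀) (h1 : MemP2 μ₁)
    {E₀ E₁ : ℝ} (hE0 : Ent μ₀ m = (E₀ : EReal)) (hE1 : Ent μ₁ m = (E₁ : EReal)) :
    ∃ μ : ℝ → Measure X, ∀ t ∈ Icc (0:ℝ) 1, IsProbabilityMeasure (μ t) ∧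
      Wsq μ₀ (μ t) = ENNReal.ofReal (t ^ 2) * Wsq μ₀ μ₁ ∧
      ∀ f : X → ℝ, Measurable f → ∀ C : ℝ, (∀ x, |f x| ≤ C) → ∫ x, Real.exp (f x) ∂m ≤ 1 →
        ∫ x, f x ∂(μ t) ≤ (1 - t) * E₀ + t * E₁ - K / 2 * (t * (1 - t)) * (Wsq μ₀ μ₁).toReal := by
  obtain ⟨μ, hμ0, hμ1, hgeo, hent⟩ := hCD μ₀ μ₁ h0 h1
  have hW := Wsq_lt_top h0 h1
  refine ⟨μ, fun t ht => ?_⟩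
  have hWt := geod_Wsq hgeo ht
  rw [hμ0, hμ1] at hWt
  have hlt : Wsq μ₀ (μ t) < ∞ := by rw [hWt]; exact ENNReal.mul_lt_top ENNReal.ofReal_lt_top hW
  obtain ⟨q, hq, -⟩ := exists_coupling_of_Wsq_lt hlt
  have := h0.1
  have hp : IsProbabilityMeasure (μ t) := hq.prob_right
  refine ⟨hp, hWt, fun f hf C hC hexp => ?_⟩
  have h2 := (Ent_ge (μ t) m f hf C hC hexp).trans (hent t ht)
  rw [hE0, hE1, ← EReal.coe_ennreal_toReal hW.ne] at h2
  exact_mod_cast h2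

lemma exists_density_ball {X : Type*} [MetricSpace X] [TopologicalSpace.SeparableSpace X]
    [MeasurableSpace X] [BorelSpace X] (m : Measure X) [IsProbabilityMeasure m]
    (B : Set X) (hB : MeasurableSet B) (x₀ : X) (R : ℝ) (hBR : ∀ x ∈ B, dist x x₀ ≤ R)
    (hm : 1 / 2 ≤ m.real B) :
    ∃ (ν : Measure X) (E : ℝ), MemP2 ν ∧ Ent ν m = (E : EReal) ∧ E ≤ Real.log 2 ∧
      (∫⁻ x in B, edist x x₀ ^ 2 ∂m ≤ ∫⁻ x, edist x x₀ ^ 2 ∂ν) ∧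
      ∫⁻ x, edist x x₀ ^ 2 ∂ν ≤ ENNReal.ofReal R ^ 2 := by
  have hpos : 0 < m.real B := by linarith
  set c : ℝ := (m.real B)⁻¹ with hc
  have hc0 : 0 < c := inv_pos.2 hpos
  have hc1 : 1 ≤ c := (one_le_inv₀ hpos).2 measureReal_le_one
  have hc2 : c ≤ 2 := by
    rw [hc, inv_le_comm₀ hpos two_pos]; linarith
  set r : X → ℝ := B.indicator fun _ => c with hr
  have hrm : Measurable r := measurable_const.indicator hB
  have hr0 : ∀ x, 0 ≤ r x := fun x => indicator_nonneg (fun _ _ => hc0.le) x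
  have hrc : ∀ x, r x ≤ 2 := fun x => by
    by_cases hx : x ∈ B
    · simp [hr, hx, hc2]
    · simp [hr, hx]
  have hr1 : ∫ x, r x ∂m = 1 := by
    rw [hr, integral_indicator_const _ hB, smul_eq_mul, hc, mul_inv_cancel₀ hpos.ne']
  have hlog : ∀ x, r x * Real.log (r x) = B.indicator (fun _ => c * Real.log c) x := fun x => by
    by_cases hx : x ∈ B
    · simp [hr, hx]
    · simp [hr, hx]
  have := UniformSpace.secondCountable_of_separable X
  have hprob := prob_withDensity m r hrm hr0 2 hrc hr1
  have hform : ∫⁻ x, edist x x₀ ^ 2 ∂(m.withDensity fun x => ENNReal.ofReal (r x))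
      = ∫⁻ x, ENNReal.ofReal (r x) * edist x x₀ ^ 2 ∂m :=
    lintegral_withDensity_eq_lintegral_mul _ hrm.ennreal_ofReal (by fun_prop)
  have hup : ∫⁻ x, edist x x₀ ^ 2 ∂(m.withDensity fun x => ENNReal.ofReal (r x))
      ≤ ENNReal.ofReal R ^ 2 := by
    calc _ ≤ ∫⁻ x, ENNReal.ofReal (r x) * ENNReal.ofReal R ^ 2 ∂m := by
          rw [hform]
          refine lintegral_mono fun x => ?_
          by_cases hx : x ∈ B
          · dsimp only
            gcongr
            rw [edist_dist]
            exact ENNReal.ofReal_le_ofReal (hBR x hx)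
          · simp [hr, hx]
      _ = (∫⁻ x, ENNReal.ofReal (r x) ∂m) * ENNReal.ofReal R ^ 2 :=
          lintegral_mul_const _ hrm.ennreal_ofReal
      _ = ENNReal.ofReal R ^ 2 := by
          have := hprob.measure_univ
          rw [withDensity_apply _ MeasurableSet.univ, Measure.restrict_univ] at this
          rw [this, one_mul]
  refine ⟨m.withDensity fun x => ENNReal.ofReal (r x), ∫ x, r x * Real.log (r x) ∂m,
    ⟨hprob, x₀, hup.trans_lt (by finiteness)⟩, Ent_withDensity m r hrm hr0 2 hrc, ?_, ?_, hup⟩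
  · simp_rw [hlog]
    rw [integral_indicator_const _ hB, smul_eq_mul, ← mul_assoc, hc, mul_inv_cancel₀ hpos.ne',
      one_mul]
    exact Real.log_le_log hc0 hc2
  · rw [hform, ← lintegral_indicator hB]
    refine lintegral_mono fun x => ?_
    by_cases hx : x ∈ B
    · simp only [hr, hx, indicator_of_mem]
      exact le_mul_of_one_le_left zero_le (by simpa using hc1)
    · simp [hr, hx]

lemma memP2_of_CD {X : Type*} [MetricSpace X] [TopologicalSpace.SeparableSpace X]
    [MeasurableSpace X] [BorelSpace X] (m : Measure X) [IsProbabilityMeasure m]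
    (K : ℝ) (hK : 0 < K) (hCD : CDinfty K m) : MemP2 m := by
  refine ⟨inferInstance, ?_⟩
  have := UniformSpace.secondCountable_of_separable X
  obtain ⟨x₀⟩ : Nonempty X := nonempty_of_isProbabilityMeasure m
  set B : ℕ → Set X := fun n => Metric.closedBall x₀ n with hBdef
  have hBm : ∀ n, MeasurableSet (B n) := fun n => Metric.isClosed_closedBall.measurableSet
  have hmono : Monotone B := fun a b hab => Metric.closedBall_subset_closedBall (by exact_mod_cast hab)
  have hU : ⋃ n, B n = univ := Metric.iUnion_closedBall_nat x₀
  have htend : Tendsto (fun n => m (B n)) atTop (𝓝 1) := by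
    have := tendsto_measure_iUnion_atTop (μ := m) hmono
    rwa [hU, measure_univ] at this
  have htr : Tendsto (fun n => m.real (B n)) atTop (𝓝 1) := by
    have := (ENNReal.tendsto_toReal ENNReal.one_ne_top).comp htend
    rw [ENNReal.toReal_one] at this
    exact this
  obtain ⟨N, hN⟩ := eventually_atTop.1 (htr.eventually (lt_mem_nhds (show (1/2:ℝ) < 1 by norm_num)))
  obtain ⟨ν, E, hν, hE, hEl, -, hNb⟩ := exists_density_ball m (B N) (hBm N) x₀ N
    (fun x hx => hx) (hN N le_rfl).le
  set C : ℝ≥0∞ := 4 * (ENNReal.ofReal (8 * Real.log 2 / K + 1) + ENNReal.ofReal N ^ 2) with hCdef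
  have hbound : ∀ n, ∫⁻ x in B n, edist x x₀ ^ 2 ∂m ≤ C := by
    have hlarge : ∀ n ≥ N, ∫⁻ x in B n, edist x x₀ ^ 2 ∂m ≤ C := by
      intro n hn
      obtain ⟨ν', E', hν', hE', hEl', hlow, -⟩ := exists_density_ball m (B n) (hBm n) x₀ n
        (fun x hx => hx) (hN n hn).le
      obtain ⟨μ, hμ⟩ := cd_real m K hCD hν hν' hE hE'
      obtain ⟨-, -, h⟩ := hμ (1/2) ⟨by norm_num, by norm_num⟩
      have h := h (fun _ => 0) measurable_const 0 (by simp) (by simp)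
      have hW := Wsq_lt_top hν hν'
      have hw : (Wsq ν ν').toReal < 8 * Real.log 2 / K + 1 := by
        have : (Wsq ν ν').toReal ≤ 8 * Real.log 2 / K := by
          rw [le_div_iff₀ hK]
          simp only [integral_zero] at h
          linarith
        linarith
      have hw' : Wsq ν ν' < ENNReal.ofReal (8 * Real.log 2 / K + 1) := by
        rwa [ENNReal.lt_ofReal_iff_toReal_lt hW.ne]
      obtain ⟨q, hq, hqc⟩ := exists_coupling_of_Wsq_lt hw'
      refine hlow.trans ?_
      calc ∫⁻ x, edist x x₀ ^ 2 ∂ν' = ∫⁻ p, edist p.2 x₀ ^ 2 ∂q := by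
            conv_lhs => rw [← hq.2]
            rw [lintegral_map (by fun_prop) measurable_snd]
        _ ≤ ∫⁻ p, 4 * (edist p.1 p.2 ^ 2 + edist p.1 x₀ ^ 2) ∂q := by
            refine lintegral_mono fun p => ?_
            refine le_trans ?_ (ennreal_add_sq_le _ _)
            gcongr
            rw [edist_comm p.1 p.2]
            exact edist_triangle _ _ _
        _ = 4 * (∫⁻ p, edist p.1 p.2 ^ 2 ∂q + ∫⁻ x, edist x x₀ ^ 2 ∂ν) := by
            rw [lintegral_const_mul _ (by fun_prop), lintegral_add_left (by fun_prop)]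
            conv_rhs => rw [← hq.1]
            rw [lintegral_map (by fun_prop) measurable_fst]
        _ ≤ C := by rw [hCdef]; gcongr
    intro n
    exact (lintegral_mono_set (hmono (le_max_left n N))).trans (hlarge _ (le_max_right n N))
  refine ⟨x₀, lt_of_le_of_lt ?_ (show C < ∞ by rw [hCdef]; finiteness)⟩
  have := setLIntegral_iUnion_of_directed (μ := m) (fun x => edist x x₀ ^ 2)
    (hmono.directed_le)
  rw [hU, Measure.restrict_univ] at this
  rw [this]
  exact iSup_le hbound

lemma key_ineq {X : Type*} [MetricSpace X] [TopologicalSpace.SeparableSpace X]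
    [MeasurableSpace X] [BorelSpace X] (m : Measure X) [IsProbabilityMeasure m]
    (K : ℝ) (hK : 0 < K) (hCD : CDinfty K m) {μ₀ : Measure X} (h0 : MemP2 μ₀) (h1 : MemP2 m)
    (f g : X → ℝ) (hf : Measurable f) (C : ℝ) (hC : ∀ x, |f x| ≤ C)
    (hexp : ∫ x, Real.exp (f x) ∂m ≤ 1)
    (hE0 : Ent μ₀ m = ((∫ x, f x ∂μ₀ : ℝ) : EReal))
    (hg : Measurable g) (D : ℝ) (hD : ∀ x, |g x| ≤ D) (A : ℝ)
    (hfg : ∀ x y, f x - f y ≤ g x * dist x y + A * dist x y ^ 2) :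
    ∫ x, f x ∂μ₀ ≤ 1 / (2 * K) * ∫ x, g x ^ 2 ∂μ₀ := by
  have := UniformSpace.secondCountable_of_separable X
  have hp0 := h0.1
  have hE1 : Ent m m = ((0:ℝ) : EReal) := by
    have h := Ent_withDensity m (fun _ => 1) measurable_const (by simp) 1 (by simp)
    simpa using h
  obtain ⟨μ, hμ⟩ := cd_real m K hCD h0 h1 hE0 hE1
  have hW := Wsq_lt_top h0 h1
  set w := (Wsq μ₀ m).toReal with hw
  have hw0 : 0 ≤ w := ENNReal.toReal_nonneg
  set E := ∫ x, f x ∂μ₀ with hE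
  set J := ∫ x, g x ^ 2 ∂μ₀ with hJ
  have hA0 : ∀ x y, f x - f y ≤ g x * dist x y + |A| * dist x y ^ 2 := fun x y =>
    (hfg x y).trans (by gcongr; exact le_abs_self A)
  have step : ∀ t ∈ Ioc (0:ℝ) 1,
      E ≤ 1 / (2 * K) * J + (K / 2 * t + |A| * t * (w + t) + K / 2 * t * w) := by
    intro t ht
    have ht0 := ht.1
    obtain ⟨hpt, hWt, hent⟩ := hμ t ⟨ht.1.le, ht.2⟩
    have hent := hent f hf C hC hexp
    have hlt : Wsq μ₀ (μ t) < ENNReal.ofReal (t ^ 2 * (w + t)) := by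
      rw [hWt, ← ENNReal.ofReal_toReal hW.ne, ← ENNReal.ofReal_mul (by positivity)]
      refine (ENNReal.ofReal_lt_ofReal_iff (by positivity)).2 ?_
      rw [← hw]
      have : 0 < t ^ 2 := by positivity
      nlinarith
    obtain ⟨q, hq, hqc⟩ := exists_coupling_of_Wsq_lt hlt
    have hqp : IsProbabilityMeasure q := hq.prob_left
    have hed : ∀ p : X × X, edist p.1 p.2 ^ 2 = ENNReal.ofReal (dist p.1 p.2 ^ 2) := fun p => by
      rw [edist_dist, ENNReal.ofReal_pow dist_nonneg]
    simp_rw [hed] at hqc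
    have hdm : Measurable fun p : X × X => dist p.1 p.2 ^ 2 := by fun_prop
    have hdi : Integrable (fun p : X × X => dist p.1 p.2 ^ 2) q := by
      refine ⟨hdm.aestronglyMeasurable, ?_⟩
      rw [hasFiniteIntegral_iff_ofReal (ae_of_all _ fun p => by positivity)]
      exact hqc.trans ENNReal.ofReal_lt_top
    have hdle : ∫ p, dist p.1 p.2 ^ 2 ∂q ≤ t ^ 2 * (w + t) := by
      rw [integral_eq_lintegral_of_nonneg_ae (ae_of_all _ fun p => by positivity)
        hdm.aestronglyMeasurable]
      exact ENNReal.toReal_le_of_le_ofReal (by positivity) hqc.le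
    have hf1 : Integrable (fun p : X × X => f p.1) q :=
      Integrable.mono' (integrable_const C) (hf.comp measurable_fst).aestronglyMeasurable
        (ae_of_all _ fun p => hC _)
    have hf2 : Integrable (fun p : X × X => f p.2) q :=
      Integrable.mono' (integrable_const C) (hf.comp measurable_snd).aestronglyMeasurable
        (ae_of_all _ fun p => hC _)
    have hg1 : Integrable (fun p : X × X => g p.1 ^ 2) q :=
      Integrable.mono' (integrable_const (D ^ 2))
        ((hg.comp measurable_fst).pow_const 2).aestronglyMeasurable
        (ae_of_all _ fun p => by
          rw [Real.norm_eq_abs, abs_pow]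
          exact pow_le_pow_left₀ (abs_nonneg _) (hD _) 2)
    have e1 : ∫ p, f p.1 ∂q = E := by
      rw [hE, ← hq.1, integral_map measurable_fst.aemeasurable hf.aestronglyMeasurable]
    have e2 : ∫ p, f p.2 ∂q = ∫ x, f x ∂(μ t) := by
      rw [← hq.2, integral_map measurable_snd.aemeasurable hf.aestronglyMeasurable]
    have e3 : ∫ p, g p.1 ^ 2 ∂q = J := by
      rw [hJ, ← hq.1, integral_map measurable_fst.aemeasurable
        (hg.pow_const 2).aestronglyMeasurable]
    have hpt : ∀ p : X × X, f p.1 - f p.2 ≤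
        t / (2 * K) * g p.1 ^ 2 + (K / (2 * t) + |A|) * dist p.1 p.2 ^ 2 := by
      intro p
      have h2 := hA0 p.1 p.2
      have h3 : g p.1 * dist p.1 p.2 ≤
          t / (2 * K) * g p.1 ^ 2 + K / (2 * t) * dist p.1 p.2 ^ 2 := by
        have h4 : t / (2 * K) * g p.1 ^ 2 + K / (2 * t) * dist p.1 p.2 ^ 2 - g p.1 * dist p.1 p.2
            = (t * g p.1 - K * dist p.1 p.2) ^ 2 / (2 * K * t) := by
          field_simp; ring
        have h5 : 0 ≤ (t * g p.1 - K * dist p.1 p.2) ^ 2 / (2 * K * t) := by positivity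
        linarith
      linarith
    have hIntg := integral_mono (hf1.sub hf2)
      ((hg1.const_mul (t / (2 * K))).add (hdi.const_mul (K / (2 * t) + |A|))) hpt
    have i1 := integral_sub hf1 hf2
    have i2 := integral_add (hg1.const_mul (t / (2 * K))) (hdi.const_mul (K / (2 * t) + |A|))
    simp only [Pi.add_apply, Pi.sub_apply] at hIntg i1 i2
    rw [i1, i2, integral_const_mul, integral_const_mul, e1, e2, e3] at hIntg
    have hcoef : 0 ≤ K / (2 * t) + |A| := by positivity
    have h6 := mul_le_mul_of_nonneg_left hdle hcoef
    have h7 : (K / (2 * t) + |A|) * (t ^ 2 * (w + t))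
        = t * (K / 2 * (w + t) + |A| * t * (w + t)) := by field_simp
    have h8 : t / (2 * K) * J = t * (1 / (2 * K) * J) := by ring
    have h9 : t * E ≤ t * (1 / (2 * K) * J +
        (K / 2 * t + |A| * t * (w + t) + K / 2 * t * w)) := by
      nlinarith
    exact le_of_mul_le_mul_left h9 ht0
  have hlim : Tendsto (fun t : ℝ => 1 / (2 * K) * J +
      (K / 2 * t + |A| * t * (w + t) + K / 2 * t * w)) (𝓝[>] 0) (𝓝 (1 / (2 * K) * J)) := by
    have : Continuous (fun t : ℝ => 1 / (2 * K) * J +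
      (K / 2 * t + |A| * t * (w + t) + K / 2 * t * w)) := by fun_prop
    have h := (this.tendsto 0).mono_left (nhdsWithin_le_nhds (s := Ioi 0))
    simpa using h
  refine ge_of_tendsto hlim ?_
  filter_upwards [Ioc_mem_nhdsGT (zero_lt_one' ℝ)] with t ht using step t ht

/-- Descending difference quotient at scale `s`. -/
def descQ {X : Type*} [MetricSpace X] (f : X → ℝ) (s : ℝ) (x : X) : ℝ≥0∞ :=
  ⨆ y, ⨆ (_ : 0 < dist x y ∧ dist x y < s), ENNReal.ofReal ((f x - f y) / dist x y)

lemma measurable_descQ {X : Type*} [MetricSpace X] [MeasurableSpace X] [BorelSpace X]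
    (f : X → ℝ) (hf : Continuous f) (s : ℝ) : Measurable (descQ f s) := by
  refine measurable_of_Ioi fun a => ?_
  have : descQ f s ⁻¹' Ioi a =
      ⋃ y, {x | (0 < dist x y ∧ dist x y < s) ∧ a < ENNReal.ofReal ((f x - f y) / dist x y)} := by
    ext x
    simp only [descQ, mem_preimage, mem_Ioi, lt_iSup_iff, mem_iUnion, mem_ofPred_eq, exists_prop]
  rw [this]
  refine (isOpen_iUnion fun y => ?_).measurableSet
  rw [isOpen_iff_mem_nhds]
  rintro x ⟨⟨h1, h2⟩, h3⟩
  have hd : ContinuousAt (fun x => dist x y) x := by fun_prop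
  have hc : ContinuousAt (fun x => ENNReal.ofReal ((f x - f y) / dist x y)) x :=
    ENNReal.continuous_ofReal.continuousAt.comp
      ((hf.continuousAt.sub continuousAt_const).div hd h1.ne')
  exact ((hd.eventually (lt_mem_nhds h1)).and (hd.eventually (gt_mem_nhds h2))).and
    (hc.eventually (lt_mem_nhds h3))

lemma descQ_le {X : Type*} [MetricSpace X] (f : X → ℝ) (s : ℝ) (x : X) (c : ℝ)
    (h : ∀ y, 0 < dist x y → dist x y < s → f x - f y ≤ c * dist x y) :
    descQ f s x ≤ ENNReal.ofReal c := by
  refine iSup_le fun y => iSup_le fun hy => ENNReal.ofReal_le_ofReal ?_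
  rw [div_le_iff₀ hy.1]
  exact h y hy.1 hy.2

lemma le_descQ {X : Type*} [MetricSpace X] (f : X → ℝ) (s : ℝ) (x y : X) (hfin : descQ f s x ≠ ∞)
    (h1 : 0 < dist x y) (h2 : dist x y < s) : f x - f y ≤ (descQ f s x).toReal * dist x y := by
  rw [← div_le_iff₀ h1]
  refine (ENNReal.ofReal_le_iff_le_toReal hfin).1 ?_
  exact le_iSup₂_of_le (f := fun y (_ : 0 < dist x y ∧ dist x y < s) =>
    ENNReal.ofReal ((f x - f y) / dist x y)) y ⟨h1, h2⟩ le_rfl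

lemma lipSlope_spec {X : Type*} [MetricSpace X] {L : NNReal} (ρ : X → ℝ) (hL : LipschitzWith L ρ)
    (x : X) : 0 ≤ lipSlope ρ x ∧ ∀ δ > 0, ∀ᶠ y in 𝓝 x, |ρ y - ρ x| ≤ (lipSlope ρ x + δ) * dist y x := by
  have hbdd : ∀ y, |ρ y - ρ x| / dist y x ≤ L := fun y =>
    div_le_of_le_mul₀ dist_nonneg L.2 (by simpa [Real.dist_eq] using hL.dist_le_mul y x)
  have hnn : ∀ y, 0 ≤ |ρ y - ρ x| / dist y x := fun y => by positivity
  have hb : IsBoundedUnder (· ≤ ·) (𝓝[≠] x) (fun y => |ρ y - ρ x| / dist y x) :=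
    isBoundedUnder_of ⟨L, hbdd⟩
  have h0 : 0 ≤ lipSlope ρ x := by
    rcases (𝓝[≠] x).eq_or_neBot with h | h
    · rw [lipSlope, h]; simp [limsup, limsSup]
    · exact le_limsup_of_frequently_le (Frequently.of_forall hnn) hb
  refine ⟨h0, fun δ hδ => ?_⟩
  have h1 : ∀ᶠ y in 𝓝[≠] x, |ρ y - ρ x| / dist y x < lipSlope ρ x + δ := by
    rcases (𝓝[≠] x).eq_or_neBot with h | h
    · rw [h]; exact eventually_bot
    · exact eventually_lt_of_limsup_lt (by rw [lipSlope]; linarith) hb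
  rw [eventually_nhdsWithin_iff] at h1
  filter_upwards [h1] with y hy
  by_cases hyx : y = x
  · subst hyx; simp
  · exact ((div_lt_iff₀ (dist_pos.2 hyx)).1 (hy hyx)).le

lemma log_sub_le {u v : ℝ} (hu : 0 < u) (hv : 0 < v) : Real.log u - Real.log v ≤ (u - v) / v := by
  rw [← Real.log_div hu.ne' hv.ne', sub_div, div_self hv.ne']
  exact Real.log_le_sub_one_of_pos (by positivity)

/-- Pointwise bound on the small-scale descending quotient of `log (ρ + ε)`. -/
lemma limsup_descQ_le {X : Type*} [MetricSpace X] {L : NNReal} (ρ : X → ℝ)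
    (hL : LipschitzWith L ρ) (hnn : ∀ x, 0 ≤ ρ x) (ε : ℝ) (hε : 0 < ε) (c : ℝ) (x : X)
    (δ : ℝ) (hδ : 0 < δ) (hδε : δ < ε) :
    ∀ᶠ n : ℕ in atTop, descQ (fun x => Real.log (ρ x + ε) - c) (1 / ((n:ℝ) + 1)) x
      ≤ ENNReal.ofReal ((lipSlope ρ x + δ) / (ρ x + ε - δ)) := by
  obtain ⟨h0, h1⟩ := lipSlope_spec ρ hL x
  have h2 : ∀ᶠ y in 𝓝 x, ρ x - δ < ρ y :=
    hL.continuous.continuousAt.eventually (lt_mem_nhds (by linarith))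
  obtain ⟨s, hs, hball⟩ := Metric.eventually_nhds_iff.1 ((h1 δ hδ).and h2)
  have h3 := (tendsto_one_div_add_atTop_nhds_zero_nat (𝕜 := ℝ)).eventually (gt_mem_nhds hs)
  filter_upwards [h3] with n hn
  refine descQ_le _ _ _ _ fun y hy1 hy2 => ?_
  obtain ⟨h4, h5⟩ := hball (y := y) (by rw [dist_comm]; exact hy2.trans hn)
  rw [dist_comm y x] at h4
  have hx := hnn x
  have hy := hnn y
  have hden : 0 < ρ x + ε - δ := by linarith
  have h6 := log_sub_le (u := ρ x + ε) (v := ρ y + ε) (by linarith) (by linarith)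
  have h7 : (ρ x + ε - (ρ y + ε)) / (ρ y + ε) ≤ |ρ y - ρ x| / (ρ y + ε) := by
    gcongr
    rw [abs_sub_comm]
    refine le_trans ?_ (le_abs_self _)
    linarith
  have h8 : |ρ y - ρ x| / (ρ y + ε) ≤ ((lipSlope ρ x + δ) * dist x y) / (ρ x + ε - δ) := by
    gcongr
    linarith
  rw [div_mul_eq_mul_div]
  linarith

lemma descQ_eq_zero {X : Type*} [MetricSpace X] (ρ : X → ℝ) (hnn : ∀ x, 0 ≤ ρ x)
    (ε : ℝ) (hε : 0 < ε) (c s : ℝ) (x : X) (hx : ρ x = 0) :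
    descQ (fun x => Real.log (ρ x + ε) - c) s x = 0 := by
  have := descQ_le (fun x => Real.log (ρ x + ε) - c) s x 0 fun y _ _ => by
    have : Real.log (ρ x + ε) ≤ Real.log (ρ y + ε) :=
      Real.log_le_log (by rw [hx]; linarith) (by rw [hx]; linarith [hnn y])
    linarith
  simpa using this

lemma limsup_pt {X : Type*} [MetricSpace X] {L : NNReal} (ρ : X → ℝ)
    (hL : LipschitzWith L ρ) (hnn : ∀ x, 0 ≤ ρ x) (ε : ℝ) (hε : 0 < ε) (c : ℝ) (x : X) :
    limsup (fun n : ℕ => ENNReal.ofReal ((ρ x + ε) / (1 + ε)) *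
      descQ (fun x => Real.log (ρ x + ε) - c) (1 / ((n:ℝ) + 1)) x ^ 2) atTop
    ≤ indicator {x | 0 < ρ x} (fun x => ENNReal.ofReal (lipSlope ρ x ^ 2 / ρ x)) x := by
  have hx := hnn x
  by_cases hpos : 0 < ρ x
  · rw [indicator_of_mem (show x ∈ {x | 0 < ρ x} from hpos)]
    have hl0 := (lipSlope_spec ρ hL x).1
    have hall : ∀ δ ∈ Ioo 0 ε, limsup (fun n : ℕ => ENNReal.ofReal ((ρ x + ε) / (1 + ε)) *
        descQ (fun x => Real.log (ρ x + ε) - c) (1 / ((n:ℝ) + 1)) x ^ 2) atTop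
        ≤ ENNReal.ofReal ((ρ x + ε) / (1 + ε) * ((lipSlope ρ x + δ) / (ρ x + ε - δ)) ^ 2) := by
      intro δ hδ
      refine limsup_le_of_le (by isBoundedDefault) ?_
      filter_upwards [limsup_descQ_le ρ hL hnn ε hε c x δ hδ.1 hδ.2] with n hn
      have h1 : 0 < ρ x + ε - δ := by linarith [hδ.2]
      rw [ENNReal.ofReal_mul (by positivity),
        ENNReal.ofReal_pow (div_nonneg (by linarith [hδ.1]) h1.le)]
      gcongr
    have hlim : Tendsto (fun δ : ℝ => ENNReal.ofReal ((ρ x + ε) / (1 + ε) *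
        ((lipSlope ρ x + δ) / (ρ x + ε - δ)) ^ 2)) (𝓝[>] 0)
        (𝓝 (ENNReal.ofReal ((ρ x + ε) / (1 + ε) *
        ((lipSlope ρ x + 0) / (ρ x + ε - 0)) ^ 2))) := by
      refine ENNReal.tendsto_ofReal ?_
      have : ContinuousAt (fun δ : ℝ => (ρ x + ε) / (1 + ε) *
        ((lipSlope ρ x + δ) / (ρ x + ε - δ)) ^ 2) 0 := by
        refine continuousAt_const.mul (ContinuousAt.pow (ContinuousAt.div (by fun_prop)
          (by fun_prop) (by linarith)) 2)
      exact this.tendsto.mono_left nhdsWithin_le_nhds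
    refine (ge_of_tendsto hlim ?_).trans (ENNReal.ofReal_le_ofReal ?_)
    · filter_upwards [Ioo_mem_nhdsGT hε] with δ hδ using hall δ hδ
    · rw [add_zero, sub_zero]
      have : (ρ x + ε) / (1 + ε) * (lipSlope ρ x / (ρ x + ε)) ^ 2
          = lipSlope ρ x ^ 2 / ((1 + ε) * (ρ x + ε)) := by
        field_simp
      rw [this]
      gcongr
      nlinarith
  · have h0 : ρ x = 0 := le_antisymm (not_lt.1 hpos) hx
    rw [indicator_of_notMem (show x ∉ {x | 0 < ρ x} from hpos)]
    simp [descQ_eq_zero ρ hnn ε hε c _ x h0]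

lemma lsi_eps {X : Type*} [MetricSpace X] [TopologicalSpace.SeparableSpace X]
    [MeasurableSpace X] [BorelSpace X] (m : Measure X) [IsProbabilityMeasure m]
    (K : ℝ) (hK : 0 < K) (hCD : CDinfty K m)
    (ρ : X → ℝ) (hnn : ∀ x, 0 ≤ ρ x) (C : ℝ) (hC : ∀ x, ρ x ≤ C)
    (L : NNReal) (hL : LipschitzWith L ρ) (hmass : ∫ x, ρ x ∂m = 1) (ε : ℝ) (hε : 0 < ε) :
    ENNReal.ofReal (∫ x, (ρ x + ε) / (1 + ε) * Real.log ((ρ x + ε) / (1 + ε)) ∂m) ≤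
      ENNReal.ofReal (1 / (2 * K)) *
        ∫⁻ x in {x | 0 < ρ x}, ENNReal.ofReal (lipSlope ρ x ^ 2 / ρ x) ∂m := by
  have hρm : Measurable ρ := hL.continuous.measurable
  have hm2 := memP2_of_CD m K hK hCD
  set r : X → ℝ := fun x => (ρ x + ε) / (1 + ε) with hr
  have hrm : Measurable r := (hρm.add_const ε).div_const _
  have hr0 : ∀ x, 0 < r x := fun x => by have := hnn x; rw [hr]; positivity
  have hrC : ∀ x, r x ≤ (C + ε) / (1 + ε) := fun x => by
    have := hC x; rw [hr]; dsimp only; gcongr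
  have hρi : Integrable ρ m := Integrable.mono' (integrable_const C) hρm.aestronglyMeasurable
    (ae_of_all _ fun x => by rw [Real.norm_eq_abs, abs_of_nonneg (hnn x)]; exact hC x)
  have hr1 : ∫ x, r x ∂m = 1 := by
    rw [hr, integral_div, integral_add hρi (integrable_const _), hmass]
    simp only [integral_const, probReal_univ, one_smul]
    exact div_self (by positivity)
  set c := Real.log (1 + ε) with hc
  set f : X → ℝ := fun x => Real.log (ρ x + ε) - c with hf
  have hfr : ∀ x, f x = Real.log (r x) := fun x => by
    have := hnn x
    rw [hr, hf, hc]; dsimp only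
    rw [Real.log_div (by positivity) (by positivity)]
  have hfcont : Continuous f := by
    refine Continuous.sub (Continuous.log (hL.continuous.add continuous_const) fun x => ?_)
      continuous_const
    have := hnn x; positivity
  set μ₀ := m.withDensity fun x => ENNReal.ofReal (r x) with hμ₀
  have hP := memP2_withDensity m hm2 r hrm (fun x => (hr0 x).le) _ hrC hr1
  have hIntg : ∀ u : X → ℝ, ∫ x, u x ∂μ₀ = ∫ x, r x * u x ∂m := fun u => by
    rw [hμ₀, integral_withDensity_eq_integral_toReal_smul hrm.ennreal_ofReal
      (ae_of_all _ fun x => ENNReal.ofReal_lt_top)]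
    simp_rw [ENNReal.toReal_ofReal (hr0 _).le, smul_eq_mul]
  have hE : Ent μ₀ m = ((∫ x, f x ∂μ₀ : ℝ) : EReal) := by
    rw [Ent_withDensity m r hrm (fun x => (hr0 x).le) _ hrC, hIntg]
    simp_rw [hfr]
  have hexp : ∫ x, Real.exp (f x) ∂m ≤ 1 := by
    simp_rw [hfr, Real.exp_log (hr0 _)]; exact hr1.le
  have hfb : ∀ x, |f x| ≤ |Real.log ε| + |Real.log (C + ε)| + |c| := fun x => by
    have h1 := hnn x
    have h2 : Real.log ε ≤ Real.log (ρ x + ε) := Real.log_le_log hε (by linarith)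
    have h3 : Real.log (ρ x + ε) ≤ Real.log (C + ε) :=
      Real.log_le_log (by linarith) (by linarith [hC x])
    have a1 := neg_abs_le (Real.log ε)
    have a2 := le_abs_self (Real.log (C + ε))
    have a3 := neg_abs_le c
    have a4 := le_abs_self c
    have a5 := abs_nonneg (Real.log ε)
    have a6 := abs_nonneg (Real.log (C + ε))
    rw [abs_le, hf]
    dsimp only
    constructor <;> linarith
  have hfL : ∀ x y, f x - f y ≤ L / ε * dist x y := fun x y => by
    have h1 := hnn x
    have h2 := hnn y
    have h3 := log_sub_le (u := ρ x + ε) (v := ρ y + ε) (by linarith) (by linarith)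
    have h4 : ρ x - ρ y ≤ L * dist x y :=
      (le_abs_self _).trans (by simpa [Real.dist_eq] using hL.dist_le_mul x y)
    have h5 : (ρ x + ε - (ρ y + ε)) / (ρ y + ε) ≤ L * dist x y / (ρ y + ε) := by
      gcongr; linarith
    have h6 : L * dist x y / (ρ y + ε) ≤ L * dist x y / ε := by
      gcongr; linarith
    rw [hf, div_mul_eq_mul_div]
    dsimp only
    linarith
  have hQb : ∀ s x, descQ f s x ≤ ENNReal.ofReal (L / ε) := fun s x =>
    descQ_le _ _ _ _ fun y _ _ => hfL x y
  have hQfin : ∀ s x, descQ f s x ≠ ∞ := fun s x => ((hQb s x).trans_lt ENNReal.ofReal_lt_top).ne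
  have hΛ : 0 ≤ (L:ℝ) / ε := div_nonneg L.2 hε.le
  have hn : ∀ n : ℕ, ENNReal.ofReal (∫ x, r x * Real.log (r x) ∂m) ≤
      ENNReal.ofReal (1 / (2 * K)) *
        ∫⁻ x, ENNReal.ofReal (r x) * descQ f (1 / ((n:ℝ) + 1)) x ^ 2 ∂m := by
    intro n
    set s : ℝ := 1 / ((n:ℝ) + 1) with hs
    have hs0 : 0 < s := by positivity
    have hgm : Measurable fun x => (descQ f s x).toReal :=
      (measurable_descQ f hfcont s).ennreal_toReal
    have hgb : ∀ x, |(descQ f s x).toReal| ≤ L / ε := fun x => by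
      rw [abs_of_nonneg ENNReal.toReal_nonneg]
      exact ENNReal.toReal_le_of_le_ofReal hΛ (hQb s x)
    have h := key_ineq m K hK hCD hP hm2 f (fun x => (descQ f s x).toReal) hfcont.measurable _ hfb
      hexp hE hgm _ hgb (L / ε / s) (fun x y => by
        rcases (dist_nonneg (x := x) (y := y)).eq_or_lt with h | h
        · rw [dist_eq_zero.1 h.symm]; simp
        · by_cases h2 : dist x y < s
          · refine (le_descQ f s x y (hQfin s x) h h2).trans ?_
            have : 0 ≤ L / ε / s * dist x y ^ 2 := by positivity
            linarith
          · have h3 := hfL x y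
            have h4 : L / ε * dist x y ≤ L / ε / s * dist x y ^ 2 := by
              have : L / ε / s * dist x y ^ 2 = L / ε * dist x y * (dist x y / s) := by ring
              rw [this]
              exact le_mul_of_one_le_right (by positivity) ((one_le_div hs0).2 (not_lt.1 h2))
            have h5 : 0 ≤ (descQ f s x).toReal * dist x y := by positivity
            linarith)
    rw [hIntg, hIntg] at h
    simp_rw [hfr] at h
    refine (ENNReal.ofReal_le_ofReal h).trans ?_
    rw [ENNReal.ofReal_mul (by positivity)]
    gcongr
    have hi : Integrable (fun x => r x * (descQ f s x).toReal ^ 2) m := by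
      refine Integrable.mono' (integrable_const ((C + ε) / (1 + ε) * (L / ε) ^ 2))
        (hrm.mul (hgm.pow_const 2)).aestronglyMeasurable (ae_of_all _ fun x => ?_)
      have h1 := hgb x
      have h2 := hrC x
      have h3 := hr0 x
      rw [Real.norm_eq_abs, abs_mul, abs_pow, abs_of_pos h3]
      gcongr
      exact h3.le.trans h2
    rw [ofReal_integral_eq_lintegral_ofReal hi (ae_of_all _ fun x =>
      mul_nonneg (hr0 x).le (by positivity))]
    refine lintegral_mono fun x => ?_
    dsimp only
    rw [ENNReal.ofReal_mul (hr0 x).le, ENNReal.ofReal_pow ENNReal.toReal_nonneg,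
      ENNReal.ofReal_toReal (hQfin s x)]
  have hS : MeasurableSet {x | 0 < ρ x} := measurableSet_lt measurable_const hρm
  have hlimsup := limsup_lintegral_le (μ := m)
    (f := fun (n : ℕ) x => ENNReal.ofReal (r x) * descQ f (1 / ((n:ℝ) + 1)) x ^ 2)
    (fun _ => ENNReal.ofReal ((C + ε) / (1 + ε)) * ENNReal.ofReal (L / ε) ^ 2)
    (fun n => hrm.ennreal_ofReal.mul ((measurable_descQ f hfcont _).pow_const 2))
    (fun n => ae_of_all _ fun x => by
      have h1 := hQb (1 / ((n:ℝ) + 1)) x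
      have h2 := hrC x
      dsimp only
      gcongr)
    (by simp only [lintegral_const, measure_univ, mul_one]; finiteness)
  have hfin : limsup (fun n : ℕ => ∫⁻ x, ENNReal.ofReal (r x) * descQ f (1 / ((n:ℝ) + 1)) x ^ 2 ∂m)
      atTop ≤ ∫⁻ x in {x | 0 < ρ x}, ENNReal.ofReal (lipSlope ρ x ^ 2 / ρ x) ∂m := by
    refine hlimsup.trans ?_
    rw [← lintegral_indicator hS]
    exact lintegral_mono fun x => limsup_pt ρ hL hnn ε hε c x
  have ha0 : ENNReal.ofReal (1 / (2 * K)) ≠ 0 := by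
    rw [Ne, ENNReal.ofReal_eq_zero, not_le]; positivity
  refine le_trans ?_ (mul_le_mul_right hfin _)
  rw [mul_comm, ← ENNReal.div_le_iff_le_mul (Or.inl ha0) (Or.inl ENNReal.ofReal_ne_top)]
  refine le_limsup_of_frequently_le (Frequently.of_forall fun n => ?_) (by isBoundedDefault)
  rw [ENNReal.div_le_iff_le_mul (Or.inl ha0) (Or.inl ENNReal.ofReal_ne_top), mul_comm]
  exact hn n

/-- **Logarithmic Sobolev inequality** under CD(K,∞), `K > 0`. -/
theorem log_sobolev_inequality
    {X : Type*} [MetricSpace X] [CompleteSpace X] [TopologicalSpace.SeparableSpace X]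
    [MeasurableSpace X] [BorelSpace X] (m : Measure X) [IsProbabilityMeasure m]
    (K : ℝ) (hK : 0 < K) (hCD : CDinfty K m)
    (ρ : X → ℝ) (hnn : ∀ x, 0 ≤ ρ x) (hbd : ∃ C, ∀ x, |ρ x| ≤ C)
    (hlip : ∃ L, LipschitzWith L ρ) (hmass : ∫ x, ρ x ∂m = 1) :
    ENNReal.ofReal (∫ x, ρ x * Real.log (ρ x) ∂m) ≤
      ENNReal.ofReal (1 / (2 * K)) *
        ∫⁻ x in {x | 0 < ρ x}, ENNReal.ofReal (lipSlope ρ x ^ 2 / ρ x) ∂m := by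
  obtain ⟨C, hC⟩ := hbd
  obtain ⟨L, hL⟩ := hlip
  have hC' : ∀ x, ρ x ≤ C := fun x => (le_abs_self _).trans (hC x)
  have hρm : Measurable ρ := hL.continuous.measurable
  obtain ⟨B, hB⟩ := (isCompact_Icc (a := (0:ℝ)) (b := C + 1)).exists_bound_of_continuousOn
    Real.continuous_mul_log.continuousOn
  have hlim : Tendsto (fun ε : ℝ => ∫ x, (ρ x + ε) / (1 + ε) * Real.log ((ρ x + ε) / (1 + ε)) ∂m)
      (𝓝[>] 0) (𝓝 (∫ x, ρ x * Real.log (ρ x) ∂m)) := by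
    refine tendsto_integral_filter_of_dominated_convergence (fun _ => B) ?_ ?_
      (integrable_const B) ?_
    · refine Eventually.of_forall fun ε => ?_
      have h : Measurable fun x => (ρ x + ε) / (1 + ε) := (hρm.add_const ε).div_const _
      exact (h.mul (Real.measurable_log.comp h)).aestronglyMeasurable
    · filter_upwards [Ioc_mem_nhdsGT (zero_lt_one' ℝ)] with ε hε
      refine ae_of_all _ fun x => hB _ ⟨?_, ?_⟩
      · have := hnn x
        have := hε.1
        positivity
      · have h1 := hnn x
        have h2 := hC' x
        rw [div_le_iff₀ (by linarith [hε.1])]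
        nlinarith [hε.1, hε.2]
    · refine ae_of_all _ fun x => ?_
      have h1 : ContinuousAt (fun ε : ℝ => (ρ x + ε) / (1 + ε)) 0 :=
        ContinuousAt.div (by fun_prop) (by fun_prop) (by norm_num)
      have h2 : ContinuousAt (fun ε : ℝ =>
          (ρ x + ε) / (1 + ε) * Real.log ((ρ x + ε) / (1 + ε))) 0 :=
        ContinuousAt.comp (g := fun y : ℝ => y * Real.log y)
          Real.continuous_mul_log.continuousAt h1
      have h3 := h2.tendsto.mono_left (nhdsWithin_le_nhds (s := Ioi 0))
      simpa using h3
  refine le_of_tendsto (ENNReal.tendsto_ofReal hlim) ?_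
  filter_upwards [self_mem_nhdsWithin] with ε hε
  exact lsi_eps m K hK hCD ρ hnn C hC' L hL hmass ε hε

end
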